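/- Let K and L be compact Hausdorff spaces, μ a finite positive regular Borel measure on L, and T : C(K;ℂ) → L¹(L,μ) an order-bounded linear operator with linear modulus |T|. Let Λ_T and Λ_{|T|} be the unique continuous linear functionals on C(K×L;ℂ) with Λ_T(f⊗g) = ∫_L (Tf)·g dμ and Λ_{|T|}(f⊗g) = ∫_L (|T|f)·g dμ for all f ∈ C(K), g ∈ C(L). Then for every 0 ≤ F ∈ C(K×L;ℂ): Λ_{|T|}(F) = sup{ |Λ_T(G)| : G ∈ C(K×L;ℂ), |G| ≤ F }. (Equivalently, the total variation measure of the complex regular Borel measure μ_T representing Λ_T equals the positive measure μ_{|T|} representing Λ_{|T|}.) In particular, the norm of Λ_T equals ∫_L |T|𝟙 dμ. -/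

import Mathlib

open MeasureTheory ComplexConjugate
open scoped ENNReal ComplexOrder

noncomputable section

variable {K : Type*} [TopologicalSpace K] [CompactSpace K] [T2Space K]
variable {L : Type*} [TopologicalSpace L] [CompactSpace L] [T2Space L]
  [MeasurableSpace L] [BorelSpace L]

/-- `T : C(K;ℂ) → L¹(L,μ)` is order-bounded. -/
def OrderBounded {μ : Measure L} (T : C(K, ℂ) → Lp ℂ 1 μ) : Prop :=
  ∀ f : C(K, ℂ), (∀ t, 0 ≤ f t) → ∃ h : Lp ℂ 1 μ, (∀ᵐ x ∂μ, 0 ≤ h x) ∧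
    ∀ g : C(K, ℂ), (∀ t, (‖g t‖ : ℂ) ≤ f t) → ∀ᵐ x ∂μ, (‖T g x‖ : ℂ) ≤ h x

/-- `T` is a positive operator. -/
def PositiveOp {μ : Measure L} (T : C(K, ℂ) → Lp ℂ 1 μ) : Prop :=
  ∀ f : C(K, ℂ), (∀ t, 0 ≤ f t) → ∀ᵐ x ∂μ, 0 ≤ T f x

/-- `absT` is a linear modulus for `T`. -/
def IsLinearModulus {μ : Measure L} (T absT : C(K, ℂ) → Lp ℂ 1 μ) : Prop :=
  ∀ f : C(K, ℂ), (∀ t, 0 ≤ f t) →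
    (∀ g : C(K, ℂ), (∀ t, (‖g t‖ : ℂ) ≤ f t) →
        ∀ᵐ x ∂μ, (‖T g x‖ : ℂ) ≤ absT f x) ∧
    (∀ h : Lp ℂ 1 μ,
        (∀ g : C(K, ℂ), (∀ t, (‖g t‖ : ℂ) ≤ f t) → ∀ᵐ x ∂μ, (‖T g x‖ : ℂ) ≤ h x) →
        ∀ᵐ x ∂μ, absT f x ≤ h x)

/-- The elementary tensor `f ⊗ g ∈ C(K×L;ℂ)`. -/
def tensorCM (f : C(K, ℂ)) (g : C(L, ℂ)) : C(K × L, ℂ) :=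
  ⟨fun p => f p.1 * g p.2,
    ((f.continuous.comp continuous_fst).mul (g.continuous.comp continuous_snd))⟩

set_option linter.unusedSectionVars false

/-- The inclusion of real-valued into complex-valued continuous functions. -/
def complexify {X : Type*} [TopologicalSpace X] (f : C(X, ℝ)) : C(X, ℂ) :=
  ⟨fun x => (f x : ℂ), Complex.continuous_ofReal.comp f.continuous⟩

@[simp] lemma complexify_apply {X : Type*} [TopologicalSpace X] (f : C(X, ℝ)) (x : X) :
    complexify f x = (f x : ℂ) := rfl

/-- The modulus of a functional `Λ`, evaluated at a (nonnegative) function `F`. -/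
def functionalModulus {X : Type*} [TopologicalSpace X] [CompactSpace X]
    (Λ : C(X, ℂ) →L[ℂ] ℂ) (F : C(X, ℝ)) : ℝ :=
  sSup {r : ℝ | ∃ G : C(X, ℂ), (∀ z, ‖G z‖ ≤ F z) ∧ r = ‖Λ G‖}

section FunctionalModulus

variable {X : Type*} [TopologicalSpace X] [CompactSpace X] (Λ : C(X, ℂ) →L[ℂ] ℂ)

lemma norm_le_functionalModulus {F : C(X, ℝ)} {G : C(X, ℂ)} (hG : ∀ z, ‖G z‖ ≤ F z) :
    ‖Λ G‖ ≤ functionalModulus Λ F := by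
  refine le_csSup ⟨‖Λ‖ * ‖F‖, ?_⟩ ⟨G, hG, rfl⟩
  rintro _ ⟨H, hH, rfl⟩
  refine (Λ.le_opNorm H).trans (mul_le_mul_of_nonneg_left ?_ (norm_nonneg _))
  exact (ContinuousMap.norm_le _ (norm_nonneg _)).2 fun z =>
    (hH z).trans ((le_abs_self _).trans (F.norm_coe_le_norm z))

lemma functionalModulus_le {F : C(X, ℝ)} (hF : ∀ z, 0 ≤ F z) {c : ℝ}
    (h : ∀ G : C(X, ℂ), (∀ z, ‖G z‖ ≤ F z) → ‖Λ G‖ ≤ c) : functionalModulus Λ F ≤ c := by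
  refine csSup_le ⟨‖Λ 0‖, 0, by simpa using hF, rfl⟩ ?_
  rintro _ ⟨G, hG, rfl⟩
  exact h G hG

lemma exists_norm_one_mul_eq_norm (z : ℂ) : ∃ c : ℂ, ‖c‖ = 1 ∧ c * z = ‖z‖ := by
  rcases eq_or_ne z 0 with rfl | hz
  · exact ⟨1, by simp⟩
  · have hz' : (‖z‖ : ℂ) ≠ 0 := by simpa using hz
    refine ⟨conj z / ‖z‖, by simp [hz], ?_⟩
    rw [div_mul_eq_mul_div, Complex.conj_mul', div_eq_iff hz', sq]

lemma functionalModulus_add_le {F₁ F₂ : C(X, ℝ)} (h₁ : ∀ z, 0 ≤ F₁ z) (h₂ : ∀ z, 0 ≤ F₂ z) :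
    functionalModulus Λ F₁ + functionalModulus Λ F₂ ≤ functionalModulus Λ (F₁ + F₂) := by
  rw [← le_sub_iff_add_le]
  refine functionalModulus_le Λ h₁ fun G₁ hG₁ => ?_
  rw [le_sub_comm]
  refine functionalModulus_le Λ h₂ fun G₂ hG₂ => ?_
  rw [le_sub_iff_add_le]
  obtain ⟨c₁, hc₁, e₁⟩ := exists_norm_one_mul_eq_norm (Λ G₁)
  obtain ⟨c₂, hc₂, e₂⟩ := exists_norm_one_mul_eq_norm (Λ G₂)
  have key : ‖Λ (c₂ • G₂ + c₁ • G₁)‖ = ‖Λ G₂‖ + ‖Λ G₁‖ := by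
    rw [map_add, map_smul, map_smul, smul_eq_mul, smul_eq_mul, e₁, e₂, ← Complex.ofReal_add,
      Complex.norm_real, Real.norm_of_nonneg (by positivity)]
  rw [← key]
  refine norm_le_functionalModulus Λ fun z => (norm_add_le _ _).trans ?_
  simp only [ContinuousMap.smul_apply, ContinuousMap.add_apply, norm_smul, hc₁, hc₂, one_mul]
  linarith [hG₁ z, hG₂ z]

lemma sum_functionalModulus_le {ι : Type*} (s : Finset ι) (F : ι → C(X, ℝ))
    (h : ∀ i ∈ s, ∀ z, 0 ≤ F i z) :
    ∑ i ∈ s, functionalModulus Λ (F i) ≤ functionalModulus Λ (∑ i ∈ s, F i) := by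
  classical
  induction s using Finset.induction_on with
  | empty =>
    exact (norm_nonneg (Λ 0)).trans (norm_le_functionalModulus Λ (by simp))
  | insert a s ha ih =>
    rw [Finset.sum_insert ha, Finset.sum_insert ha]
    have hs : ∀ i ∈ s, ∀ z, 0 ≤ F i z := fun i hi => h i (Finset.mem_insert_of_mem hi)
    refine (add_le_add_right (ih hs) _).trans
      (functionalModulus_add_le Λ (h a (Finset.mem_insert_self _ _)) fun z => ?_)
    rw [ContinuousMap.sum_apply]
    exact Finset.sum_nonneg fun i hi => hs i hi z

lemma functionalModulus_le_of_le_add {F F' : C(X, ℝ)} (hF : ∀ z, 0 ≤ F z) (hF' : ∀ z, 0 ≤ F' z)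
    {ε : ℝ} (hε : 0 < ε) (h : ∀ z, F' z ≤ F z + ε) :
    functionalModulus Λ F' ≤ functionalModulus Λ F + ‖Λ‖ * ε := by
  refine functionalModulus_le Λ hF' fun G hG => ?_
  have hpos : ∀ z, 0 < F z + ε := fun z => by linarith [hF z]
  let r : C(X, ℝ) := ⟨fun z => F z / (F z + ε),
    F.continuous.div (F.continuous.add continuous_const) fun z => (hpos z).ne'⟩
  have hr : ∀ z, ‖(complexify r * G) z‖ ≤ F z := fun z => by
    have : 0 ≤ r z := div_nonneg (hF z) (hpos z).le
    rw [ContinuousMap.mul_apply, norm_mul, complexify_apply, Complex.norm_real,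
      Real.norm_of_nonneg this]
    calc r z * ‖G z‖ ≤ r z * (F z + ε) :=
          mul_le_mul_of_nonneg_left ((hG z).trans (h z)) this
      _ = F z := div_mul_cancel₀ _ (hpos z).ne'
  have hd : ‖G - complexify r * G‖ ≤ ε := by
    refine (ContinuousMap.norm_le _ hε.le).2 fun z => ?_
    have e : (G - complexify r * G) z = ((ε / (F z + ε) : ℝ) : ℂ) * G z := by
      have : ε / (F z + ε) = 1 - r z := by
        change _ = 1 - F z / (F z + ε)
        field_simp [(hpos z).ne']
        ring
      rw [this]
      simp [sub_mul]
    have h0 : 0 ≤ ε / (F z + ε) := div_nonneg hε.le (hpos z).le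
    rw [e, norm_mul, Complex.norm_real, Real.norm_of_nonneg h0]
    calc ε / (F z + ε) * ‖G z‖ ≤ ε / (F z + ε) * (F z + ε) :=
          mul_le_mul_of_nonneg_left ((hG z).trans (h z)) h0
      _ = ε := div_mul_cancel₀ _ (hpos z).ne'
  calc ‖Λ G‖ = ‖Λ (complexify r * G) + Λ (G - complexify r * G)‖ := by
        rw [← map_add]; congr 2; abel
    _ ≤ ‖Λ (complexify r * G)‖ + ‖Λ (G - complexify r * G)‖ := norm_add_le _ _
    _ ≤ functionalModulus Λ F + ‖Λ‖ * ε := add_le_add (norm_le_functionalModulus Λ hr)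
        ((Λ.le_opNorm _).trans (mul_le_mul_of_nonneg_left hd (norm_nonneg _)))

end FunctionalModulus

/-- A continuous map on a compact space is uniformly approximated by its values at finitely many
points, weighted by a partition of unity. -/
lemma exists_partition_norm_sub_lt {X E : Type*} [TopologicalSpace X] [CompactSpace X]
    [SeminormedAddCommGroup E] {φ : X → E} (hφ : Continuous φ) {ε : ℝ} (hε : 0 < ε) :
    ∃ (t : Finset X) (g : X → C(X, ℝ)), (∀ i x, 0 ≤ g i x) ∧ (∀ x, ∑ i ∈ t, g i x = 1) ∧
      ∀ i x, g i x ≠ 0 → ‖φ x - φ i‖ < ε := by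
  obtain ⟨t, ht⟩ := CompactSpace.elim_nhds_subcover (fun i => {x | ‖φ x - φ i‖ < ε}) fun i =>
    (isOpen_lt (hφ.sub continuous_const).norm continuous_const).mem_nhds (by simpa using hε)
  have hcont : ∀ i, Continuous fun x => max 0 (ε - ‖φ x - φ i‖) := fun i =>
    continuous_const.max (continuous_const.sub (hφ.sub continuous_const).norm)
  have hpos : ∀ x, 0 < ∑ i ∈ t, max 0 (ε - ‖φ x - φ i‖) := fun x => by
    have hx : x ∈ ⋃ i ∈ t, {x | ‖φ x - φ i‖ < ε} := ht ▸ Set.mem_univ x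
    simp only [Set.mem_iUnion, Set.mem_ofPred_eq] at hx
    obtain ⟨i, hi, hx⟩ := hx
    exact Finset.sum_pos' (fun _ _ => le_max_left _ _) ⟨i, hi, lt_max_of_lt_right (sub_pos.2 hx)⟩
  refine ⟨t, fun i => ⟨fun x => max 0 (ε - ‖φ x - φ i‖) / ∑ j ∈ t, max 0 (ε - ‖φ x - φ j‖),
    (hcont i).div (continuous_finsetSum _ fun j _ => hcont j) fun x => (hpos x).ne'⟩,
    fun i x => div_nonneg (le_max_left _ _) (hpos x).le, fun x => ?_, fun i x hx => ?_⟩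
  · simp only [ContinuousMap.coe_mk]
    rw [← Finset.sum_div, div_self (hpos x).ne']
  · by_contra! h
    exact hx (by simp [max_eq_left (sub_nonpos.2 h)])

/-- A nonempty closed sup-closed subset of `L¹` with bounded integrals has a greatest element. -/
lemma exists_isGreatest_of_isClosed_supClosed {α : Type*} [MeasurableSpace α] {μ : Measure α}
    {S : Set (Lp ℝ 1 μ)} (hne : S.Nonempty) (hcl : IsClosed S) (hsup : SupClosed S)
    (hbdd : BddAbove ((fun u : Lp ℝ 1 μ => ∫ x, u x ∂μ) '' S)) : ∃ h, IsGreatest S h := by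
  have hmono : ∀ u v : Lp ℝ 1 μ, u ≤ v → ‖v - u‖ = ∫ x, v x ∂μ - ∫ x, u x ∂μ := fun u v huv => by
    rw [L1.norm_eq_integral_norm, ← integral_sub (L1.integrable_coeFn v) (L1.integrable_coeFn u)]
    refine integral_congr_ae ?_
    filter_upwards [Lp.coeFn_sub v u, (Lp.coeFn_le u v).2 huv] with x h₁ h₂
    rw [h₁, Pi.sub_apply, Real.norm_of_nonneg (sub_nonneg.2 h₂)]
  obtain ⟨w, hwm, hwt, hwS⟩ := exists_seq_tendsto_sSup (hne.image _) hbdd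
  choose u huS hu using hwS
  set c := sSup ((fun u : Lp ℝ 1 μ => ∫ x, u x ∂μ) '' S) with hc
  have hle : ∀ v ∈ S, ∫ x, v x ∂μ ≤ c := fun v hv => le_csSup hbdd ⟨v, hv, rfl⟩
  have hvS : ∀ n, partialSups u n ∈ S := fun n => by
    induction n with
    | zero => simpa using huS 0
    | succ n ih => rw [partialSups_add_one]; exact hsup ih (huS _)
  have hwle : ∀ n, w n ≤ ∫ x, partialSups u n x ∂μ := fun n => by
    rw [← hu n]
    exact integral_mono_ae (L1.integrable_coeFn _) (L1.integrable_coeFn _)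
      ((Lp.coeFn_le _ _).2 (le_partialSups u n))
  have hcau : CauchySeq (fun n => partialSups u n) := by
    refine cauchySeq_of_le_tendsto_0 (fun n => 2 * (c - w n)) (fun n m N hn hm => ?_)
      (by simpa using (hwt.const_sub c).const_mul 2)
    have aux : ∀ n, N ≤ n → ‖partialSups u n - partialSups u N‖ ≤ c - w N := fun n hn => by
      rw [hmono _ _ ((partialSups u).monotone hn)]
      linarith [hwle N, hle _ (hvS n)]
    rw [dist_eq_norm, ← sub_sub_sub_cancel_right _ _ (partialSups u N)]
    linarith [norm_sub_le (partialSups u n - partialSups u N) (partialSups u m - partialSups u N),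
      aux n hn, aux m hm]
  obtain ⟨h, hh⟩ := cauchySeq_tendsto_of_complete hcau
  have hhS : h ∈ S := hcl.mem_of_tendsto hh (Filter.Eventually.of_forall hvS)
  have hint : c ≤ ∫ x, h x ∂μ := by
    have h1 : Filter.Tendsto (fun n => ∫ x, partialSups u n x ∂μ) Filter.atTop
        (nhds (∫ x, h x ∂μ)) := (continuous_integral.tendsto h).comp hh
    exact le_of_tendsto_of_tendsto' hwt h1 hwle
  refine ⟨h, hhS, fun v hv => ?_⟩
  have h1 := hmono h (h ⊔ v) le_sup_left
  have h2 := hle _ (hsup hhS hv)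
  have h3 : h ⊔ v - h = 0 := norm_le_zero_iff.1 (by linarith)
  exact sup_eq_left.1 (sub_eq_zero.1 h3)

lemma integrable_mul_continuousMap {𝕜 : Type*} [RCLike 𝕜] {μ : Measure L} {u : L → 𝕜}
    (hu : Integrable u μ) (k : C(L, 𝕜)) : Integrable (fun y => u y * k y) μ :=
  hu.mul_bdd k.continuous.aestronglyMeasurable
    (Filter.Eventually.of_forall k.norm_coe_le_norm)

/-- Multiplication by a continuous `[0, 1]`-valued function almost extracts the positive part. -/
lemma exists_integral_posPart_mul_le {μ : Measure L} [IsFiniteMeasure μ] [μ.Regular]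
    {w : L → ℝ} (hw : Integrable w μ) {k : C(L, ℝ)} (hk : ∀ y, 0 ≤ k y) {ε : ℝ} (hε : 0 < ε) :
    ∃ a : C(L, ℝ), (∀ y, 0 ≤ a y) ∧ (∀ y, a y ≤ 1) ∧
      ∫ y, max (w y) 0 * k y ∂μ ≤ ∫ y, w y * (a y * k y) ∂μ + ε := by
  set C : ℝ := ‖k‖ * (μ.real Set.univ + 2) + 1 with hC
  have hCpos : 0 < C := by positivity
  have hδ : 0 < ε / C := div_pos hε hCpos
  set δ := ε / C with hδ_def
  obtain ⟨v, hv, hvi⟩ := hw.exists_boundedContinuous_integral_sub_le hδ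
  have hpos : ∀ y, 0 < max (v y) 0 + δ := fun y => by positivity
  let a : C(L, ℝ) := ⟨fun y => max (v y) 0 / (max (v y) 0 + δ),
    (v.continuous.max continuous_const).div
      ((v.continuous.max continuous_const).add continuous_const) fun y => (hpos y).ne'⟩
  have ha0 : ∀ y, 0 ≤ a y := fun y => div_nonneg (le_max_right _ _) (hpos y).le
  have ha1 : ∀ y, a y ≤ 1 := fun y => (div_le_one (hpos y)).2 (by linarith)
  have hva : ∀ y, max (v y) 0 - δ ≤ v y * a y := fun y => by
    change _ ≤ v y * (max (v y) 0 / (max (v y) 0 + δ))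
    rcases le_total (v y) 0 with h | h
    · simp [max_eq_right h, hδ.le]
    · rw [max_eq_left h, ← mul_div_assoc, le_div_iff₀ (by positivity)]
      nlinarith [sq_nonneg δ]
  have hpt : ∀ y, max (w y) 0 * k y ≤ w y * (a y * k y) + (δ + 2 * ‖w y - v y‖) * ‖k‖ := fun y => by
    have h1 : max (w y) 0 ≤ max (v y) 0 + ‖w y - v y‖ := by
      refine max_le ?_ (by positivity)
      linarith [le_max_left (v y) 0, Real.le_norm_self (w y - v y)]
    have h2 : v y * a y ≤ w y * a y + ‖w y - v y‖ := by
      have h3 : (v y - w y) * a y ≤ ‖w y - v y‖ * 1 := by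
        rw [norm_sub_rev]
        exact mul_le_mul (Real.le_norm_self _) (ha1 y) (ha0 y) (norm_nonneg _)
      linarith
    have h4 : max (w y) 0 ≤ w y * a y + (δ + 2 * ‖w y - v y‖) := by linarith [hva y]
    have h5 : k y ≤ ‖k‖ := (Real.le_norm_self _).trans (k.norm_coe_le_norm y)
    have h6 : (δ + 2 * ‖w y - v y‖) * k y ≤ (δ + 2 * ‖w y - v y‖) * ‖k‖ :=
      mul_le_mul_of_nonneg_left h5 (by positivity)
    nlinarith [mul_le_mul_of_nonneg_right h4 (hk y)]
  have hi1 : Integrable (fun y => w y * (a y * k y)) μ := integrable_mul_continuousMap hw (a * k)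
  have hi2 : Integrable (fun y => 2 * ‖w y - v y‖) μ := (hw.sub hvi).norm.const_mul 2
  have hi3 : Integrable (fun y => (δ + 2 * ‖w y - v y‖) * ‖k‖) μ :=
    ((integrable_const δ).add hi2).mul_const _
  refine ⟨a, ha0, ha1, ?_⟩
  calc ∫ y, max (w y) 0 * k y ∂μ
      ≤ ∫ y, w y * (a y * k y) + (δ + 2 * ‖w y - v y‖) * ‖k‖ ∂μ :=
        integral_mono (integrable_mul_continuousMap hw.pos_part k) (hi1.add hi3) hpt
    _ = ∫ y, w y * (a y * k y) ∂μ + (μ.real Set.univ * δ + 2 * ∫ y, ‖w y - v y‖ ∂μ) * ‖k‖ := by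
        rw [integral_add hi1 hi3, integral_mul_const, integral_add (integrable_const δ) hi2,
          integral_const_mul, integral_const, smul_eq_mul]
    _ ≤ ∫ y, w y * (a y * k y) ∂μ + ε := by
        have h1 : (μ.real Set.univ * δ + 2 * ∫ y, ‖w y - v y‖ ∂μ) * ‖k‖
            ≤ (μ.real Set.univ * δ + 2 * δ) * ‖k‖ := by gcongr
        have h2 : C * δ = ε := mul_div_cancel₀ _ hCpos.ne'
        have h3 : C * δ = (μ.real Set.univ * δ + 2 * δ) * ‖k‖ + δ := by rw [hC]; ring
        linarith

/-- The densities dominated by a superadditive function on nonnegative continuous functions. -/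
def dominatedDensities (μ : Measure L) (q : C(L, ℝ) → ℝ) : Set (Lp ℝ 1 μ) :=
  {u | ∀ k : C(L, ℝ), (∀ y, 0 ≤ k y) → ∫ y, u y * k y ∂μ ≤ q k}

lemma supClosed_dominatedDensities {μ : Measure L} [IsFiniteMeasure μ] [μ.Regular]
    {q : C(L, ℝ) → ℝ} (hq : ∀ k₁ k₂ : C(L, ℝ), (∀ y, 0 ≤ k₁ y) → (∀ y, 0 ≤ k₂ y) →
      q k₁ + q k₂ ≤ q (k₁ + k₂)) : SupClosed (dominatedDensities μ q) := by
  intro u hu v hv k hk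
  refine le_of_forall_pos_le_add fun ε hε => ?_
  have hui := L1.integrable_coeFn u
  have hvi := L1.integrable_coeFn v
  obtain ⟨a, ha0, ha1, ha⟩ := exists_integral_posPart_mul_le (hui.sub hvi) hk hε
  have h1 : ∫ y, (u ⊔ v) y * k y ∂μ
      = ∫ y, v y * k y ∂μ + ∫ y, max ((u - v : L → ℝ) y) 0 * k y ∂μ := by
    rw [← integral_add (integrable_mul_continuousMap hvi k)
      (integrable_mul_continuousMap (hui.sub hvi).pos_part k)]
    refine integral_congr_ae ?_
    filter_upwards [Lp.coeFn_sup u v] with y hy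
    rw [hy, Pi.sup_apply, Pi.sub_apply, ← add_mul]
    congr 1
    rcases le_total (u y) (v y) with h | h
    · simp [h]
    · simp [h]
  have h2 : ∫ y, v y * k y ∂μ + ∫ y, (u - v : L → ℝ) y * (a y * k y) ∂μ
      = ∫ y, u y * (a * k) y ∂μ + ∫ y, v y * ((1 - a) * k) y ∂μ := by
    have hi : Integrable (fun y => (u - v : L → ℝ) y * (a y * k y)) μ :=
      integrable_mul_continuousMap (hui.sub hvi) (a * k)
    rw [← integral_add (integrable_mul_continuousMap hvi k) hi,
      ← integral_add (integrable_mul_continuousMap hui _) (integrable_mul_continuousMap hvi _)]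
    refine integral_congr_ae (Filter.Eventually.of_forall fun y => ?_)
    simp only [Pi.sub_apply, ContinuousMap.mul_apply, ContinuousMap.sub_apply,
      ContinuousMap.one_apply]
    ring
  have n1 : ∀ y, 0 ≤ (a * k) y := fun y => mul_nonneg (ha0 y) (hk y)
  have n2 : ∀ y, 0 ≤ ((1 - a) * k) y := fun y => mul_nonneg (sub_nonneg.2 (ha1 y)) (hk y)
  have h3 := hq _ _ n1 n2
  rw [← add_mul, add_sub_cancel, one_mul] at h3
  linarith [hu _ n1, hv _ n2]

lemma isClosed_dominatedDensities {μ : Measure L} (q : C(L, ℝ) → ℝ) :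
    IsClosed (dominatedDensities μ q) := by
  simp only [dominatedDensities, Set.ofPred_forall]
  refine isClosed_iInter fun k => isClosed_iInter fun _ => isClosed_le ?_ continuous_const
  refine (LipschitzWith.of_dist_le_mul (K := ‖k‖₊) fun u v => ?_).continuous
  have hui := L1.integrable_coeFn u
  have hvi := L1.integrable_coeFn v
  rw [dist_eq_norm, ← integral_sub (integrable_mul_continuousMap hui k)
    (integrable_mul_continuousMap hvi k), dist_eq_norm, L1.norm_eq_integral_norm, coe_nnnorm,
    ← integral_const_mul]
  refine norm_integral_le_of_norm_le ((L1.integrable_coeFn (u - v)).norm.const_mul _) ?_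
  filter_upwards [Lp.coeFn_sub u v] with y hy
  rw [← sub_mul, norm_mul, hy, mul_comm]
  exact mul_le_mul_of_nonneg_right (k.norm_coe_le_norm y) (norm_nonneg _)

/-- The tensor product of two real-valued continuous functions. -/
def realTensor (f : C(K, ℝ)) (g : C(L, ℝ)) : C(K × L, ℝ) :=
  ⟨fun p => f p.1 * g p.2,
    (f.continuous.comp continuous_fst).mul (g.continuous.comp continuous_snd)⟩

/-- The restriction of a function on `K × L` to a horizontal slice. -/
def slice {E : Type*} [TopologicalSpace E] (F : C(K × L, E)) (y : L) : C(K, E) :=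
  ⟨fun s => F (s, y), F.continuous.comp (continuous_id.prodMk continuous_const)⟩

lemma complexify_realTensor (f : C(K, ℝ)) (g : C(L, ℝ)) :
    complexify (realTensor f g) = tensorCM (complexify f) (complexify g) := by
  ext p
  simp [realTensor, tensorCM]

lemma continuous_slice {E : Type*} [TopologicalSpace E] (F : C(K × L, E)) :
    Continuous (slice F) :=
  ((F.comp ContinuousMap.prodSwap).curry).continuous

lemma norm_sub_sum_tensorCM_le (G : C(K × L, ℂ)) {t : Finset L} {g : L → C(L, ℝ)}
    (hg : ∀ i y, 0 ≤ g i y) (hsum : ∀ y, ∑ i ∈ t, g i y = 1) {ε : ℝ} (hε : 0 < ε)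
    (h : ∀ i y, g i y ≠ 0 → ‖slice G y - slice G i‖ ≤ ε) :
    ‖G - ∑ i ∈ t, tensorCM (slice G i) (complexify (g i))‖ ≤ ε := by
  refine (ContinuousMap.norm_le _ hε.le).2 fun z => ?_
  have e : (G - ∑ i ∈ t, tensorCM (slice G i) (complexify (g i))) z
      = ∑ i ∈ t, (slice G z.2 - slice G i) z.1 * (g i z.2 : ℂ) := by
    simp only [ContinuousMap.sub_apply, ContinuousMap.sum_apply, sub_mul, Finset.sum_sub_distrib]
    rw [← Finset.mul_sum, ← Complex.ofReal_sum, hsum]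
    simp [slice, tensorCM]
  rw [e]
  calc ‖∑ i ∈ t, (slice G z.2 - slice G i) z.1 * (g i z.2 : ℂ)‖
      ≤ ∑ i ∈ t, ε * g i z.2 := norm_sum_le_of_le _ fun i _ => by
        rw [norm_mul, Complex.norm_real, Real.norm_of_nonneg (hg i z.2)]
        by_cases h0 : g i z.2 = 0
        · simp [h0]
        · exact mul_le_mul_of_nonneg_right
            ((ContinuousMap.norm_coe_le_norm _ _).trans (h i _ h0)) (hg i _)
    _ = ε := by rw [← Finset.mul_sum, hsum, mul_one]

/-- Two continuous functions on `K × L` are simultaneously approximated by finite sums of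
elementary tensors of their slices with a partition of unity on `L`. -/
lemma exists_norm_sub_sum_tensorCM_le (G₁ G₂ : C(K × L, ℂ)) {ε : ℝ} (hε : 0 < ε) :
    ∃ (t : Finset L) (g : L → C(L, ℝ)), (∀ i y, 0 ≤ g i y) ∧
      ‖G₁ - ∑ i ∈ t, tensorCM (slice G₁ i) (complexify (g i))‖ ≤ ε ∧
      ‖G₂ - ∑ i ∈ t, tensorCM (slice G₂ i) (complexify (g i))‖ ≤ ε := by
  obtain ⟨t, g, hg, hsum, h⟩ := exists_partition_norm_sub_lt
    ((continuous_slice G₁).prodMk (continuous_slice G₂)) hε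
  exact ⟨t, g, hg,
    norm_sub_sum_tensorCM_le G₁ hg hsum hε fun i y hy => (norm_fst_le _).trans (h i y hy).le,
    norm_sub_sum_tensorCM_le G₂ hg hsum hε fun i y hy => (norm_snd_le _).trans (h i y hy).le⟩

lemma norm_integral_mul_le_of_isLinearModulus {μ : Measure L}
    {T absT : C(K, ℂ) → Lp ℂ 1 μ} (habs : IsLinearModulus T absT)
    {f : C(K, ℝ)} (hf : ∀ s, 0 ≤ f s) {g : C(K, ℂ)} (hg : ∀ s, ‖g s‖ ≤ f s)
    {k : C(L, ℝ)} (hk : ∀ y, 0 ≤ k y) :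
    ‖∫ y, T g y * complexify k y ∂μ‖ ≤ ∫ y, (absT (complexify f) y).re * k y ∂μ := by
  refine norm_integral_le_of_norm_le
    (integrable_mul_continuousMap (L1.integrable_coeFn (absT (complexify f))).re k) ?_
  filter_upwards [(habs (complexify f) fun s => by simpa using hf s).1 g
    fun s => by simpa using hg s] with y hy
  rw [norm_mul, complexify_apply, Complex.norm_real, Real.norm_of_nonneg (hk y)]
  exact mul_le_mul_of_nonneg_right (Complex.le_def.1 hy).1 (hk y)

/-- A complex function is bounded by `h` in norm as soon as the real parts of its rotations are. -/
lemma ae_norm_le_of_forall_re_mul_le {α : Type*} [MeasurableSpace α] {μ : Measure α}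
    {u : α → ℂ} {h : α → ℝ}
    (H : ∀ c : ℂ, ‖c‖ = 1 → ∀ᵐ x ∂μ, (c * u x).re ≤ h x) : ∀ᵐ x ∂μ, ‖u x‖ ≤ h x := by
  obtain ⟨D, hDc, hDd⟩ := TopologicalSpace.exists_countable_dense (Metric.sphere (0 : ℂ) 1)
  have hD : ∀ᵐ x ∂μ, ∀ c ∈ D, ((c : ℂ) * u x).re ≤ h x :=
    (ae_ball_iff hDc).2 fun c _ => H c (by simp)
  filter_upwards [hD] with x hx
  have hcl : IsClosed {c : Metric.sphere (0 : ℂ) 1 | ((c : ℂ) * u x).re ≤ h x} :=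
    isClosed_le (Complex.continuous_re.comp (continuous_subtype_val.mul continuous_const))
      continuous_const
  have hall : ∀ c : Metric.sphere (0 : ℂ) 1, ((c : ℂ) * u x).re ≤ h x := fun c =>
    hcl.closure_subset_iff.2 hx (hDd c)
  obtain ⟨c, hc, e⟩ := exists_norm_one_mul_eq_norm (u x)
  simpa [e] using hall ⟨c, by simpa using hc⟩

lemma integral_mul_le_functionalModulus {μ : Measure L} [IsFiniteMeasure μ] [μ.Regular]
    {T absT : C(K, ℂ) → Lp ℂ 1 μ} (habs : IsLinearModulus T absT)
    {Λ : C(K × L, ℂ) →L[ℂ] ℂ}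
    (hΛ : ∀ (f : C(K, ℂ)) (g : C(L, ℂ)), Λ (tensorCM f g) = ∫ y, T f y * g y ∂μ)
    {f : C(K, ℝ)} (hf : ∀ s, 0 ≤ f s) {k : C(L, ℝ)} (hk : ∀ y, 0 ≤ k y) :
    ∫ y, (absT (complexify f) y).re * k y ∂μ ≤ functionalModulus Λ (realTensor f k) := by
  set q : C(L, ℝ) → ℝ := fun k => functionalModulus Λ (realTensor f k) with hq_def
  have hq : ∀ k₁ k₂ : C(L, ℝ), (∀ y, 0 ≤ k₁ y) → (∀ y, 0 ≤ k₂ y) →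
      q k₁ + q k₂ ≤ q (k₁ + k₂) := fun k₁ k₂ h₁ h₂ => by
    have e : realTensor f (k₁ + k₂) = realTensor f k₁ + realTensor f k₂ := by
      ext z
      simp [realTensor, mul_add]
    simp only [hq_def, e]
    exact functionalModulus_add_le Λ (fun z => mul_nonneg (hf _) (h₁ _))
      fun z => mul_nonneg (hf _) (h₂ _)
  have hre : ∀ g : C(K, ℂ), (∀ s, ‖g s‖ ≤ f s) → ∀ c : ℂ, ‖c‖ = 1 →
      ∃ u ∈ dominatedDensities μ q, ∀ᵐ y ∂μ, u y = (c * T g y).re := fun g hg c hc => by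
    have hi : Integrable (fun y => c * T g y) μ := (L1.integrable_coeFn (T g)).const_mul c
    refine ⟨Integrable.toL1 _ hi.re, fun k hk => ?_, hi.re.coeFn_toL1⟩
    have h1 : ∫ y, Integrable.toL1 _ hi.re y * k y ∂μ = (c * Λ (tensorCM g (complexify k))).re := by
      rw [hΛ, ← integral_const_mul]
      have hi' : Integrable (fun y => c * (T g y * complexify k y)) μ :=
        (integrable_mul_continuousMap (L1.integrable_coeFn (T g)) (complexify k)).const_mul c
      refine Eq.trans ?_ (integral_re hi')
      refine integral_congr_ae ?_
      filter_upwards [hi.re.coeFn_toL1] with y hy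
      rw [hy, complexify_apply, ← mul_assoc]
      exact (Complex.re_mul_ofReal _ _).symm
    rw [h1]
    refine (Complex.re_le_norm _).trans ?_
    rw [norm_mul, hc, one_mul]
    refine norm_le_functionalModulus Λ fun z => ?_
    simp only [tensorCM, realTensor, ContinuousMap.coe_mk, norm_mul, complexify_apply,
      Complex.norm_real, Real.norm_of_nonneg (hk z.2)]
    exact mul_le_mul_of_nonneg_right (hg z.1) (hk z.2)
  obtain ⟨h, hmem, hub⟩ := exists_isGreatest_of_isClosed_supClosed
    (let ⟨u, hu, _⟩ := hre 0 (by simpa using hf) 1 (by simp); ⟨u, hu⟩)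
    (isClosed_dominatedDensities q) (supClosed_dominatedDensities hq)
    ⟨q 1, by
      rintro _ ⟨u, hu, rfl⟩
      simpa using hu 1 fun _ => zero_le_one⟩
  have hdom : ∀ g : C(K, ℂ), (∀ s, ‖g s‖ ≤ f s) → ∀ᵐ y ∂μ, ‖T g y‖ ≤ h y := fun g hg =>
    ae_norm_le_of_forall_re_mul_le fun c hc => by
      obtain ⟨u, hu, hue⟩ := hre g hg c hc
      filter_upwards [hue, (Lp.coeFn_le _ _).2 (hub hu)] with y h1 h2
      rwa [← h1]
  have hhi := L1.integrable_coeFn h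
  have hle : ∀ᵐ y ∂μ, absT (complexify f) y ≤ Integrable.toL1 _ (hhi.ofReal (𝕜 := ℂ)) y := by
    refine (habs (complexify f) fun s => by simpa using hf s).2 _ fun g hg => ?_
    filter_upwards [hdom g fun s => by simpa using hg s,
      (hhi.ofReal (𝕜 := ℂ)).coeFn_toL1] with y h1 h2
    rw [h2]
    exact Complex.real_le_real.2 h1
  refine le_trans (integral_mono_ae (integrable_mul_continuousMap
    (L1.integrable_coeFn (absT (complexify f))).re k) (integrable_mul_continuousMap hhi k) ?_)
    (hmem k hk)
  filter_upwards [hle, (hhi.ofReal (𝕜 := ℂ)).coeFn_toL1] with y h1 h2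
  rw [h2] at h1
  exact mul_le_mul_of_nonneg_right (Complex.le_def.1 h1).1 (hk y)

/-- **`|μ_T| = μ_{|T|}`** (from Theorem `ot.t:rep-mod` of the paper).  Let `T` be an
order-bounded operator `C(K;ℂ) → L¹(L,μ)` with linear modulus `|T|`, and let `Λ_T` and
`Λ_{|T|}` be the representing functionals of `T` and `|T|` on `C(K×L;ℂ)`.  Then for
`0 ≤ F` one has `Λ_{|T|}(F) = sup{ |Λ_T(G)| : |G| ≤ F }`; in particular the norm of
`Λ_T` equals `∫_L |T|𝟙 dμ`. -/
theorem rep_functional_of_modulus_eq_abs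
    (μ : Measure L) [IsFiniteMeasure μ] (hμ : μ.Regular)
    (T absT : C(K, ℂ) →ₗ[ℂ] Lp ℂ 1 μ)
    (hT : OrderBounded ⇑T) (habs_pos : PositiveOp ⇑absT)
    (habs : IsLinearModulus ⇑T ⇑absT)
    (ΛT Λabs : C(K × L, ℂ) →L[ℂ] ℂ)
    (hΛT : ∀ (f : C(K, ℂ)) (g : C(L, ℂ)),
      ΛT (tensorCM f g) = ∫ y, T f y * g y ∂μ)
    (hΛabs : ∀ (f : C(K, ℂ)) (g : C(L, ℂ)),
      Λabs (tensorCM f g) = ∫ y, absT f y * g y ∂μ) :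
    (∀ F : C(K × L, ℂ), (∀ z, 0 ≤ F z) →
      Λabs F = (sSup {r : ℝ | ∃ G : C(K × L, ℂ),
        (∀ z, (‖G z‖ : ℂ) ≤ F z) ∧ r = ‖ΛT G‖} : ℝ)) ∧
    ‖ΛT‖ = (∫ x, absT 1 x ∂μ).re := by
  have := hμ
  have hreg : ∀ f : C(K, ℝ), (∀ s, 0 ≤ f s) → ∀ k : C(L, ℝ),
      ∫ y, absT (complexify f) y * complexify k y ∂μ
        = ((∫ y, (absT (complexify f) y).re * k y ∂μ : ℝ) : ℂ) := fun f hf k => by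
    rw [← integral_complex_ofReal]
    refine integral_congr_ae ?_
    filter_upwards [habs_pos (complexify f) fun s => by simpa using hf s] with y hy
    rw [complexify_apply, Complex.ofReal_mul,
      ← Complex.eq_re_of_ofReal_le (r := 0) (by simpa using hy)]
  have key : ∀ (F : C(K × L, ℝ)) (G : C(K × L, ℂ)), (∀ z, 0 ≤ F z) → (∀ z, ‖G z‖ ≤ F z) →
      ∀ ε : ℝ, 0 < ε → ∃ R : ℝ, ‖Λabs (complexify F) - R‖ ≤ ‖Λabs‖ * ε ∧
        ‖ΛT G‖ ≤ R + ‖ΛT‖ * ε ∧ R ≤ functionalModulus ΛT F + ‖ΛT‖ * ε := by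
    intro F G hF hG ε hε
    obtain ⟨t, g, hg, h₁, h₂⟩ := exists_norm_sub_sum_tensorCM_le (complexify F) G hε
    have hsl : ∀ i, slice (complexify F) i = complexify (slice F i) := fun i => rfl
    have hslF : ∀ i s, 0 ≤ slice F i s := fun i s => hF (s, i)
    have hslG : ∀ i s, ‖slice G i s‖ ≤ slice F i s := fun i s => hG (s, i)
    refine ⟨∑ i ∈ t, ∫ y, (absT (complexify (slice F i)) y).re * g i y ∂μ, ?_, ?_, ?_⟩
    · have e : Λabs (∑ i ∈ t, tensorCM (slice (complexify F) i) (complexify (g i)))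
          = ((∑ i ∈ t, ∫ y, (absT (complexify (slice F i)) y).re * g i y ∂μ : ℝ) : ℂ) := by
        rw [map_sum, Complex.ofReal_sum]
        refine Finset.sum_congr rfl fun i _ => ?_
        rw [hΛabs, hsl, hreg _ (hslF i)]
      rw [← e, ← map_sub]
      exact (Λabs.le_opNorm _).trans (mul_le_mul_of_nonneg_left h₁ (norm_nonneg _))
    · have e : ‖ΛT (∑ i ∈ t, tensorCM (slice G i) (complexify (g i)))‖
          ≤ ∑ i ∈ t, ∫ y, (absT (complexify (slice F i)) y).re * g i y ∂μ := by
        rw [map_sum]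
        refine norm_sum_le_of_le _ fun i _ => ?_
        rw [hΛT]
        exact norm_integral_mul_le_of_isLinearModulus habs (hslF i) (hslG i) (hg i)
      have e' := (ΛT.le_opNorm _).trans (mul_le_mul_of_nonneg_left h₂ (norm_nonneg _))
      rw [map_sub] at e'
      linarith [norm_le_norm_add_norm_sub' (ΛT G)
        (ΛT (∑ i ∈ t, tensorCM (slice G i) (complexify (g i))))]
    · have n : ∀ i z, 0 ≤ realTensor (slice F i) (g i) z := fun i z =>
        mul_nonneg (hslF i z.1) (hg i z.2)
      have e : complexify (∑ i ∈ t, realTensor (slice F i) (g i))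
          = ∑ i ∈ t, tensorCM (slice (complexify F) i) (complexify (g i)) := by
        simp only [hsl, ← complexify_realTensor]
        ext z
        simp [ContinuousMap.sum_apply]
      refine (Finset.sum_le_sum fun i _ => integral_mul_le_functionalModulus habs hΛT
        (hslF i) (hg i)).trans ((sum_functionalModulus_le ΛT t _ fun i _ => n i).trans
        (functionalModulus_le_of_le_add ΛT hF (fun z => ?_) hε fun z => ?_))
      · rw [ContinuousMap.sum_apply]
        exact Finset.sum_nonneg fun i _ => n i z
      · have e' := (ContinuousMap.norm_coe_le_norm _ z).trans h₁
        rw [← e, ContinuousMap.sub_apply, complexify_apply, complexify_apply,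
          ← Complex.ofReal_sub, Complex.norm_real, Real.norm_eq_abs] at e'
        linarith [(abs_le.1 e').1]
  have hmod : ∀ F : C(K × L, ℝ), (∀ z, 0 ≤ F z) →
      Λabs (complexify F) = functionalModulus ΛT F := by
    intro F hF
    refine eq_of_forall_dist_le fun ε hε => ?_
    set C := ‖Λabs‖ + ‖ΛT‖ + 1 with hC
    have hCpos : 0 < C := by positivity
    set δ := ε / C with hδ_def
    have hδ : 0 < δ := div_pos hε hCpos
    have hCδ : ‖Λabs‖ * δ + ‖ΛT‖ * δ + δ = ε := by
      rw [← mul_div_cancel₀ ε hCpos.ne', ← hδ_def, hC]; ring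
    obtain ⟨G, hG, hlt⟩ : ∃ G : C(K × L, ℂ), (∀ z, ‖G z‖ ≤ F z) ∧
        functionalModulus ΛT F - δ < ‖ΛT G‖ := by
      by_contra! h
      linarith [functionalModulus_le ΛT hF h]
    obtain ⟨R, hR₁, hR₂, hR₃⟩ := key F G hF hG δ hδ
    have h : ‖(R : ℂ) - functionalModulus ΛT F‖ ≤ ‖ΛT‖ * δ + δ := by
      rw [← Complex.ofReal_sub, Complex.norm_real, Real.norm_eq_abs, abs_le]
      constructor <;> linarith
    rw [dist_eq_norm]
    linarith [norm_sub_le_norm_sub_add_norm_sub (Λabs (complexify F)) (R : ℂ)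
      (functionalModulus ΛT F : ℂ)]
  refine ⟨fun F hF => ?_, ?_⟩
  · let Fr : C(K × L, ℝ) := ⟨fun z => (F z).re, Complex.continuous_re.comp F.continuous⟩
    have e : complexify Fr = F := by
      ext z
      exact (Complex.eq_re_of_ofReal_le (r := 0) (by simpa using hF z)).symm
    have n : ∀ z, 0 ≤ Fr z := fun z => (Complex.nonneg_iff.1 (hF z)).1
    conv_lhs => rw [← e, hmod Fr n]
    rw [← e]
    simp only [functionalModulus, complexify_apply, Complex.real_le_real]
  · have h1 := hmod 1 fun _ => zero_le_one
    have e1 : complexify (1 : C(K × L, ℝ)) = tensorCM 1 1 := by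
      ext z
      simp [tensorCM]
    rw [e1, hΛabs] at h1
    simp only [ContinuousMap.one_apply, mul_one] at h1
    rw [h1, Complex.ofReal_re]
    refine le_antisymm (ΛT.opNorm_le_bound ?_ fun G => ?_) ?_
    · exact (norm_nonneg (ΛT 0)).trans (norm_le_functionalModulus ΛT (by simp))
    · rcases eq_or_ne G 0 with rfl | hG
      · simp
      have hG' : 0 < ‖G‖ := norm_pos_iff.2 hG
      have h2 : ‖ΛT ((‖G‖⁻¹ : ℂ) • G)‖ ≤ functionalModulus ΛT 1 :=
        norm_le_functionalModulus ΛT fun z => by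
          simpa [norm_smul, inv_mul_le_iff₀ hG'] using G.norm_coe_le_norm z
      rwa [map_smul, norm_smul, norm_inv, Complex.norm_real, norm_norm, inv_mul_le_iff₀ hG',
        mul_comm] at h2
    · refine functionalModulus_le ΛT (fun _ => zero_le_one) fun G hG => ?_
      simpa using ΛT.le_opNorm_of_le ((ContinuousMap.norm_le _ zero_le_one).2 hG)

end
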